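/- arXiv:1506.04173 — 2 statements merged into one kernel-verified Lean document; each statement's English description precedes it below -/
import Mathlib

section
/- At least 11 two-letter words (adjacent pairs) are needed to determine a 3×3 board with nine distinct letters. Precisely: if B : Fin 3 × Fin 3 → Fin 9 is a bijection and P is a finite set of unordered pairs of distinct letters, each pair occupying adjacent cells of B, such that every bijection B' : Fin 3 × Fin 3 → Fin 9 in which every pair of P occupies adjacent cells is equivalent to B, then the cardinality of P is at least 11. -/
/-- King-move adjacency on the cells of a 3×3 grid: two cells are adjacent if they are
distinct and their coordinates differ by at most 1 in each component. -/
def cellAdj (a b : Fin 3 × Fin 3) : Prop :=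
  a ≠ b ∧ |(a.1.val : ℤ) - (b.1.val : ℤ)| ≤ 1 ∧ |(a.2.val : ℤ) - (b.2.val : ℤ)| ≤ 1

/-- `w` is a word of the board `B`: a list of letters of length at least 2 of the form
`B c₁, …, B c_k` where the cells `c₁, …, c_k` are pairwise distinct and consecutive
cells are adjacent.  (For a bijective board this says exactly that `w` is a list of
pairwise distinct letters whose consecutive letters occupy adjacent cells.) -/
def IsWordOf {A : Type*} (B : Fin 3 × Fin 3 → A) (w : List A) : Prop :=
  2 ≤ w.length ∧
    ∃ cs : List (Fin 3 × Fin 3), cs.map B = w ∧ cs.Nodup ∧ cs.Chain' cellAdj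

/-- The set `W(B)` of all words of the board `B`. -/
def Words {A : Type*} (B : Fin 3 × Fin 3 → A) : Set (List A) :=
  {w | IsWordOf B w}

/-- The set `W_k(B)` of all `k`-letter words of the board `B`. -/
def WordsOfLen {A : Type*} (B : Fin 3 × Fin 3 → A) (k : ℕ) : Set (List A) :=
  {w | w.length = k ∧ IsWordOf B w}

/-- Rotation of the 3×3 grid by 90 degrees. -/
def rotCell (c : Fin 3 × Fin 3) : Fin 3 × Fin 3 := (c.2, 2 - c.1)

/-- Reflection of the 3×3 grid along the main diagonal. -/
def reflCell (c : Fin 3 × Fin 3) : Fin 3 × Fin 3 := (c.2, c.1)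

/-- The symmetry group of the square acting on the 3×3 grid: the eight
rotations and reflections. -/
def squareSymm : Set ((Fin 3 × Fin 3) → (Fin 3 × Fin 3)) :=
  {id, rotCell, rotCell ∘ rotCell, rotCell ∘ rotCell ∘ rotCell,
   reflCell, reflCell ∘ rotCell, reflCell ∘ rotCell ∘ rotCell,
   reflCell ∘ rotCell ∘ rotCell ∘ rotCell}

/-- Two boards are equivalent if one is obtained from the other by a symmetry
of the square. -/
def BoardEquiv {A : Type*} (B B' : Fin 3 × Fin 3 → A) : Prop :=
  ∃ σ ∈ squareSymm, B' = B ∘ σ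

theorem cellAdj_iff (a b : Fin 3 × Fin 3) :
    cellAdj a b ↔ a ≠ b ∧ (a.1.val ≤ b.1.val + 1 ∧ b.1.val ≤ a.1.val + 1) ∧
      (a.2.val ≤ b.2.val + 1 ∧ b.2.val ≤ a.2.val + 1) := by
  simp only [cellAdj, abs_le]
  refine and_congr_right fun _ => ?_
  omega

instance decidableCellAdj (a b : Fin 3 × Fin 3) : Decidable (cellAdj a b) :=
  decidable_of_iff' _ (cellAdj_iff a b)

/-- Branching test for hitting sets: if `needsMoreThan n L` evaluates to `true`, every finite
set meeting all members of `L` has more than `n` elements. -/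
def needsMoreThan {α : Type*} [DecidableEq α] : ℕ → List (List α) → Bool
  | _, [] => false
  | 0, _ :: _ => true
  | n + 1, D :: L => D.all fun e => needsMoreThan n (L.filter fun D' => e ∉ D')

theorem lt_card_of_needsMoreThan {α : Type*} [DecidableEq α] {n : ℕ} {L : List (List α)}
    (h : needsMoreThan n L = true) (K : Finset α) (hK : ∀ D ∈ L, ∃ e ∈ D, e ∈ K) :
    n < K.card := by
  induction n generalizing L K with
  | zero =>
    cases L with
    | nil => simp [needsMoreThan] at h
    | cons D L =>
      obtain ⟨e, -, he⟩ := hK D (by simp)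
      exact Finset.card_pos.2 ⟨e, he⟩
  | succ n ih =>
    cases L with
    | nil => simp [needsMoreThan] at h
    | cons D L =>
      obtain ⟨e, heD, heK⟩ := hK D (by simp)
      rw [needsMoreThan, List.all_eq_true] at h
      have hlt := ih (h e heD) (K.erase e) fun D' hD' => by
        obtain ⟨hD'L, heD'⟩ := List.mem_filter.1 hD'
        obtain ⟨e', he'D', he'K⟩ := hK D' (List.mem_cons_of_mem _ hD'L)
        refine ⟨e', he'D', Finset.mem_erase.2 ⟨?_, he'K⟩⟩
        rintro rfl
        simp [he'D'] at heD'
      rw [Finset.card_erase_of_mem heK] at hlt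
      omega

/-- The twenty edges of the king graph on the 3×3 grid. -/
def kingEdge : Fin 20 → (Fin 3 × Fin 3) × (Fin 3 × Fin 3) :=
  ![((0, 0), (0, 1)), ((0, 1), (0, 2)), ((1, 0), (1, 1)), ((1, 1), (1, 2)),
    ((2, 0), (2, 1)), ((2, 1), (2, 2)), ((0, 0), (1, 0)), ((1, 0), (2, 0)),
    ((0, 1), (1, 1)), ((1, 1), (2, 1)), ((0, 2), (1, 2)), ((1, 2), (2, 2)),
    ((0, 0), (1, 1)), ((0, 1), (1, 2)), ((1, 0), (2, 1)), ((1, 1), (2, 2)),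
    ((0, 1), (1, 0)), ((0, 2), (1, 1)), ((1, 1), (2, 0)), ((1, 2), (2, 1))]

theorem exists_kingEdge {c c' : Fin 3 × Fin 3} (h : cellAdj c c') :
    ∃ i, s((kingEdge i).1, (kingEdge i).2) = s(c, c') := by
  revert c c'
  decide +kernel

theorem kingEdge_injective :
    Function.Injective fun i => s((kingEdge i).1, (kingEdge i).2) := by
  unfold Function.Injective
  decide +kernel

/-- The king-graph edges which `π` maps to non-adjacent pairs of cells. -/
def brokenEdges (π : Fin 3 × Fin 3 → Fin 3 × Fin 3) : List (Fin 20) :=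
  (List.finRange 20).filter fun i => ¬ cellAdj (π (kingEdge i).1) (π (kingEdge i).2)

/-- The eight elements of `squareSymm`, as a list. -/
def squareSymmList : List (Fin 3 × Fin 3 → Fin 3 × Fin 3) :=
  [id, rotCell, rotCell ∘ rotCell, rotCell ∘ rotCell ∘ rotCell,
   reflCell, reflCell ∘ rotCell, reflCell ∘ rotCell ∘ rotCell,
   reflCell ∘ rotCell ∘ rotCell ∘ rotCell]

theorem mem_squareSymmList {σ : Fin 3 × Fin 3 → Fin 3 × Fin 3} :
    σ ∈ squareSymmList ↔ σ ∈ squareSymm := by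
  simp [squareSymmList, squareSymm]

/-- The rearrangement of the grid whose values are listed row by row, the cell `(i, j)` being
written `3 * i + j`. -/
def ofTable (t : List ℕ) (c : Fin 3 × Fin 3) : Fin 3 × Fin 3 :=
  let k := t.getD (3 * c.1.val + c.2.val) 0
  (Fin.ofNat 3 (k / 3), Fin.ofNat 3 k)

/-- Rearrangements of the grid breaking few edges, up to symmetry. -/
def basicMoves : List (Fin 3 × Fin 3 → Fin 3 × Fin 3) :=
  [ofTable [2, 1, 0, 3, 4, 5, 6, 7, 8], ofTable [0, 2, 1, 3, 4, 5, 6, 7, 8],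
   ofTable [2, 0, 1, 3, 4, 5, 6, 7, 8], ofTable [0, 1, 2, 3, 7, 5, 6, 4, 8],
   ofTable [0, 2, 8, 1, 4, 5, 6, 3, 7], ofTable [3, 1, 2, 0, 7, 5, 6, 4, 8],
   ofTable [1, 0, 3, 2, 4, 6, 5, 8, 7], ofTable [6, 1, 2, 3, 7, 5, 0, 4, 8]]

/-- The basic moves precomposed with all symmetries of the square. -/
def moves : List (Fin 3 × Fin 3 → Fin 3 × Fin 3) :=
  basicMoves.flatMap fun π => squareSymmList.map fun σ => π ∘ σ

theorem injective_of_mem_basicMoves {π : Fin 3 × Fin 3 → Fin 3 × Fin 3}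
    (hπ : π ∈ basicMoves) : Function.Injective π := by
  have h : basicMoves.all (fun π => decide (∀ a b, π a = π b → a = b)) = true := by
    decide +kernel
  exact fun a b => of_decide_eq_true (List.all_eq_true.1 h π hπ) a b

theorem injective_of_mem_squareSymmList {σ : Fin 3 × Fin 3 → Fin 3 × Fin 3}
    (hσ : σ ∈ squareSymmList) : Function.Injective σ := by
  have h : squareSymmList.all (fun σ => decide (∀ a b, σ a = σ b → a = b)) = true := by
    decide +kernel
  exact fun a b => of_decide_eq_true (List.all_eq_true.1 h σ hσ) a b

theorem injective_of_mem_moves {π : Fin 3 × Fin 3 → Fin 3 × Fin 3} (hπ : π ∈ moves) :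
    Function.Injective π := by
  simp only [moves, List.mem_flatMap, List.mem_map] at hπ
  obtain ⟨π, hπ, σ, hσ, rfl⟩ := hπ
  exact (injective_of_mem_basicMoves hπ).comp (injective_of_mem_squareSymmList hσ)

theorem cellAdj_of_mem_squareSymm {σ : Fin 3 × Fin 3 → Fin 3 × Fin 3} (hσ : σ ∈ squareSymm)
    {c c' : Fin 3 × Fin 3} (h : cellAdj (σ c) (σ c')) : cellAdj c c' := by
  have hall : squareSymmList.all
      (fun σ => decide (∀ a b, cellAdj (σ a) (σ b) → cellAdj a b)) = true := by
    decide +kernel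
  exact of_decide_eq_true (List.all_eq_true.1 hall σ (mem_squareSymmList.2 hσ)) c c' h

theorem cellAdj_kingEdge (i : Fin 20) : cellAdj (kingEdge i).1 (kingEdge i).2 := by
  revert i
  decide +kernel

/-- The edges broken by each of the `moves`, as indices into `kingEdge`. -/
def brokenSets : List (List ℕ) :=
  [[6, 10], [0, 4], [7, 11], [1, 5],
   [0, 4], [7, 11], [1, 5], [6, 10],
   [0, 16], [7, 14], [5, 19], [10, 13],
   [6, 16], [4, 14], [11, 19], [1, 13],
   [0, 6, 13], [4, 7, 16], [5, 11, 14], [1, 10, 19],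
   [0, 6, 14], [4, 7, 19], [5, 11, 13], [1, 10, 16],
   [8, 12, 17], [2, 12, 18], [9, 15, 18], [3, 15, 17],
   [2, 12, 18], [9, 15, 18], [3, 15, 17], [8, 12, 17],
   [0, 1, 7, 19], [5, 6, 7, 13], [4, 5, 10, 16], [0, 10, 11, 14],
   [1, 6, 7, 19], [4, 5, 6, 13], [4, 10, 11, 16], [0, 1, 11, 14],
   [2, 7, 8, 17], [2, 5, 9, 12], [3, 9, 10, 18], [0, 3, 8, 15],
   [1, 2, 8, 18], [2, 6, 9, 15], [3, 4, 9, 17], [3, 8, 11, 12],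
   [13, 14, 16, 19], [13, 14, 16, 19], [13, 14, 16, 19], [13, 14, 16, 19],
   [13, 14, 16, 19], [13, 14, 16, 19], [13, 14, 16, 19], [13, 14, 16, 19],
   [0, 8, 17, 18], [2, 7, 12, 15], [5, 9, 17, 18], [3, 10, 12, 15],
   [2, 6, 17, 18], [4, 9, 12, 15], [3, 11, 17, 18], [1, 8, 12, 15]]

theorem map_brokenEdges_moves : (moves.map fun π => (brokenEdges π).map Fin.val) = brokenSets := by
  decide +kernel

theorem ne_nil_of_mem_brokenSets : ∀ D ∈ brokenSets, D ≠ [] := by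
  decide +kernel

theorem needsMoreThan_brokenSets : needsMoreThan 10 brokenSets = true := by
  decide +kernel

theorem exists_brokenEdge_mem {A : Type*} {B : Fin 3 × Fin 3 → A} (hB : Function.Bijective B)
    {P : Finset (Sym2 A)}
    (hP : ∀ p ∈ P, ∃ c c' : Fin 3 × Fin 3, cellAdj c c' ∧ p = s(B c, B c'))
    (huniq : ∀ B' : Fin 3 × Fin 3 → A, Function.Bijective B' →
      (∀ p ∈ P, ∃ c c' : Fin 3 × Fin 3, cellAdj c c' ∧ p = s(B' c, B' c')) →
      BoardEquiv B B')
    {π : Fin 3 × Fin 3 → Fin 3 × Fin 3} (hπ : Function.Injective π)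
    (hne : brokenEdges π ≠ []) :
    ∃ i ∈ brokenEdges π, s(B (kingEdge i).1, B (kingEdge i).2) ∈ P := by
  by_contra! hbroken
  let e := Equiv.ofBijective π (Finite.injective_iff_bijective.1 hπ)
  obtain ⟨σ, hσ, hBσ⟩ := huniq (B ∘ e.symm) (hB.comp e.symm.bijective) fun p hp => by
    obtain ⟨c, c', hadj, rfl⟩ := hP p hp
    obtain ⟨i, hi⟩ := exists_kingEdge hadj
    have hi' : s(B (kingEdge i).1, B (kingEdge i).2) = s(B c, B c') := congrArg (Sym2.map B) hi
    refine ⟨π (kingEdge i).1, π (kingEdge i).2, ?_, ?_⟩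
    · by_contra hnot
      exact hbroken i (by simpa [brokenEdges] using hnot) (hi' ▸ hp)
    · rw [← hi']
      exact congrArg₂ (fun x y => s(B x, B y)) (e.symm_apply_apply _).symm
        (e.symm_apply_apply _).symm
  have hσe : ∀ c, σ (π c) = c := fun c =>
    hB.1 ((congrFun hBσ (π c)).symm.trans (congrArg B (e.symm_apply_apply c)))
  refine hne (List.filter_eq_nil_iff.2 fun i _ => ?_)
  have hadj : cellAdj (π (kingEdge i).1) (π (kingEdge i).2) :=
    cellAdj_of_mem_squareSymm hσ (by simpa only [hσe] using cellAdj_kingEdge i)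
  simpa using hadj

/-- At least 11 two-letter words (unordered adjacent pairs of distinct letters) are
needed to determine a 3×3 board with nine distinct letters. -/
theorem min_eleven_pairs (B : Fin 3 × Fin 3 → Fin 9) (hB : Function.Bijective B)
    (P : Finset (Sym2 (Fin 9)))
    (hP : ∀ p ∈ P, ¬ p.IsDiag ∧
      ∃ c c' : Fin 3 × Fin 3, cellAdj c c' ∧ p = s(B c, B c'))
    (huniq : ∀ B' : Fin 3 × Fin 3 → Fin 9, Function.Bijective B' →
      (∀ p ∈ P, ∃ c c' : Fin 3 × Fin 3, cellAdj c c' ∧ p = s(B' c, B' c')) →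
      BoardEquiv B B') :
    11 ≤ P.card := by
  have hlt := lt_card_of_needsMoreThan needsMoreThan_brokenSets
    ((Finset.univ.filter fun i => s(B (kingEdge i).1, B (kingEdge i).2) ∈ P).map
      Fin.valEmbedding) (by
      intro D hD
      have hne := ne_nil_of_mem_brokenSets D hD
      rw [← map_brokenEdges_moves] at hD
      obtain ⟨π, hπ, rfl⟩ := List.mem_map.1 hD
      obtain ⟨i, hi, hiP⟩ := exists_brokenEdge_mem hB (fun p hp => (hP p hp).2) huniq
        (injective_of_mem_moves hπ) (by simpa using hne)
      exact ⟨i, List.mem_map_of_mem hi,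
        Finset.mem_map_of_mem _ (Finset.mem_filter.2 ⟨Finset.mem_univ i, hiP⟩)⟩)
  rw [Finset.card_map] at hlt
  refine hlt.trans_le (Finset.card_le_card_of_injOn
    (fun i => s(B (kingEdge i).1, B (kingEdge i).2)) (fun i hi => by simpa using hi) ?_)
  exact ((Sym2.map.injective hB.1).comp kingEdge_injective).injOn
end

section
/- The standard board S and the board [(1 3)] obtained by swapping its two upper corners are not equivalent, yet they have exactly 136 three-letter words in common: the cardinality of W₃(S) ∩ W₃([(1 3)]) is 136. Hence 136 three-letter words do not suffice to guarantee a unique solution. -/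
/-- The standard board `S`: the border cells, read clockwise from the top-left
corner, carry the letters `0,…,7` and the center cell carries the letter `8`
(letters are 0-indexed, so paper letter `i` is `i - 1 : Fin 9`). -/
def stdBoard : Fin 3 × Fin 3 → Fin 9 := fun c =>
  ![![(0 : Fin 9), 1, 2], ![7, 8, 3], ![6, 5, 4]] c.1 c.2

/-- The board `[(1 3)]` obtained from the standard board by swapping the two upper
corner letters (paper letters 1 and 3, i.e. `0` and `2 : Fin 9`). -/
def swapBoard : Fin 3 × Fin 3 → Fin 9 :=
  (Equiv.swap (0 : Fin 9) 2) ∘ stdBoard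

instance : DecidableRel cellAdj := fun a b => by
  unfold cellAdj
  infer_instance

/-- For a board with inverse `g`, words are the lists of distinct letters whose
consecutive letters occupy adjacent cells. -/
theorem mem_wordsOfLen_iff {A : Type*} {B : Fin 3 × Fin 3 → A} {g : A → Fin 3 × Fin 3}
    (hl : Function.LeftInverse g B) (hr : Function.RightInverse g B) {k : ℕ} (hk : 2 ≤ k)
    (w : List A) :
    w ∈ WordsOfLen B k ↔
      w.length = k ∧ w.Nodup ∧ w.IsChain (fun a b => cellAdj (g a) (g b)) := by
  constructor
  · rintro ⟨hlen, -, cs, rfl, hnd, hch⟩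
    refine ⟨hlen, hnd.map hl.injective, ?_⟩
    rw [List.isChain_map]
    simp only [hl _]
    exact hch
  · rintro ⟨hlen, hnd, hch⟩
    refine ⟨hlen, hlen ▸ hk, w.map g, ?_, hnd.map hr.injective, ?_⟩
    · rw [List.map_map, hr.comp_eq_id, List.map_id]
    · exact (List.isChain_map g).2 hch

/-- The cell of the standard board carrying a given letter. -/
def stdCell : Fin 9 → Fin 3 × Fin 3 :=
  ![(0, 0), (0, 1), (0, 2), (1, 2), (2, 2), (2, 1), (2, 0), (1, 0), (1, 1)]

theorem stdCell_leftInverse : Function.LeftInverse stdCell stdBoard := by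
  unfold Function.LeftInverse
  decide

theorem stdCell_rightInverse : Function.RightInverse stdCell stdBoard := by
  unfold Function.RightInverse Function.LeftInverse
  decide

/-- The cell of the swapped board carrying a given letter. -/
def swapCell : Fin 9 → Fin 3 × Fin 3 :=
  stdCell ∘ Equiv.swap (0 : Fin 9) 2

theorem swapCell_leftInverse : Function.LeftInverse swapCell swapBoard := fun c => by
  simp [swapCell, swapBoard, stdCell_leftInverse c]

theorem swapCell_rightInverse : Function.RightInverse swapCell swapBoard := fun a => by
  simp [swapCell, swapBoard, stdCell_rightInverse _]

theorem not_boardEquiv_stdBoard_swapBoard : ¬ BoardEquiv stdBoard swapBoard := by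
  rintro ⟨σ, hσ, h⟩
  have h00 := congrFun h (0, 0)
  have h01 := congrFun h (0, 1)
  have h10 := congrFun h (1, 0)
  simp only [squareSymm, Set.mem_insert_iff, Set.mem_singleton_iff] at hσ
  rcases hσ with rfl | rfl | rfl | rfl | rfl | rfl | rfl | rfl <;>
    revert h00 h01 h10 <;> decide

/-- Ordered pairs of letters adjacent on both the standard and the swapped board. -/
def commonAdj (a b : Fin 9) : Prop :=
  cellAdj (stdCell a) (stdCell b) ∧ cellAdj (swapCell a) (swapCell b)

instance : DecidableRel commonAdj := fun a b => by
  unfold commonAdj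
  infer_instance

/-- The triples of letters spelling a word on both boards. -/
def commonTriples : Finset (Fin 9 × Fin 9 × Fin 9) :=
  Finset.univ.filter fun t => commonAdj t.1 t.2.1 ∧ commonAdj t.2.1 t.2.2 ∧ t.1 ≠ t.2.2

theorem card_commonTriples : commonTriples.card = 136 := by
  decide +kernel

theorem commonWords_eq_image :
    WordsOfLen stdBoard 3 ∩ WordsOfLen swapBoard 3 =
      (fun t : Fin 9 × Fin 9 × Fin 9 => [t.1, t.2.1, t.2.2]) '' commonTriples := by
  ext w
  rw [Set.mem_inter_iff, mem_wordsOfLen_iff stdCell_leftInverse stdCell_rightInverse (by norm_num),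
    mem_wordsOfLen_iff swapCell_leftInverse swapCell_rightInverse (by norm_num)]
  constructor
  · rintro ⟨⟨hlen, hnd, h₁⟩, -, -, h₂⟩
    obtain ⟨a, b, c, rfl⟩ := List.length_eq_three.1 hlen
    simp only [List.nodup_cons, List.mem_cons, not_or, List.isChain_cons_cons] at hnd h₁ h₂
    exact ⟨(a, b, c), Finset.mem_filter.2 ⟨Finset.mem_univ _, ⟨h₁.1, h₂.1⟩,
      ⟨h₁.2.1, h₂.2.1⟩, hnd.1.2.1⟩, rfl⟩
  · rintro ⟨⟨a, b, c⟩, h, rfl⟩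
    have ne_of_adj : ∀ {x y : Fin 9}, cellAdj (stdCell x) (stdCell y) → x ≠ y :=
      fun h hxy => h.1 (congrArg stdCell hxy)
    obtain ⟨⟨hab, hab'⟩, ⟨hbc, hbc'⟩, hac⟩ : commonAdj a b ∧ commonAdj b c ∧ a ≠ c := by
      simpa [commonTriples] using h
    simp [ne_of_adj hab, ne_of_adj hbc, hac, hab, hab', hbc, hbc']

/-- The standard board and the board obtained by swapping its two upper corners are
not equivalent, yet they share exactly 136 3-letter words. -/
theorem common_words_count :
    ¬ BoardEquiv stdBoard swapBoard ∧
      (WordsOfLen stdBoard 3 ∩ WordsOfLen swapBoard 3).ncard = 136 := by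
  refine ⟨not_boardEquiv_stdBoard_swapBoard, ?_⟩
  rw [commonWords_eq_image, Set.ncard_image_of_injective, Set.ncard_coe_finset,
    card_commonTriples]
  rintro ⟨a, b, c⟩ ⟨a', b', c'⟩ h
  simpa using h
end
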